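/- Let K_o = [a,b,c] be an equilateral triangle in ℝ² with side length ‖a−b‖ = 2, let a' = (b+c)/2, b' = (c+a)/2, c' = (a+b)/2, and K_i = [a',b',c']. Let K be a convex body with K_i ⊆ K ⊆ K_o. Define α₁ := max{|[x,b',c']|/|[a,b',c']| : x ∈ K ∩ [a,b',c']}, α₂ := max{|[x,c',a']|/|[b,c',a']| : x ∈ K ∩ [b,c',a']}, α₃ := max{|[x,a',b']|/|[c,a',b']| : x ∈ K ∩ [c,a',b']}, and α := (α₁+α₂+α₃)/3 ∈ [0,1]. Then |K|·|((K−K)/2)*| ≥ 6 + (3/2)·α·(1−α). -/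

import Mathlib

open MeasureTheory Pointwise Real
open scoped RealInnerProductSpace

/-- Area (two-dimensional Lebesgue measure) of a subset of the plane `ℂ ≅ ℝ²`. -/
noncomputable def area (K : Set ℂ) : ℝ := (volume K).toReal

/-- The polar body `K* = {x : ⟨x,y⟩ ≤ 1 for all y ∈ K}`. -/
def polarBody (K : Set ℂ) : Set ℂ := {x | ∀ y ∈ K, ⟪x, y⟫ ≤ 1}

/-- A convex body: a compact convex set with nonempty interior. -/
def IsConvexBody (K : Set ℂ) : Prop := Convex ℝ K ∧ IsCompact K ∧ (interior K).Nonempty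

/-- The signed area of the parallelogram spanned by two plane vectors. -/
def cross (u v : ℂ) : ℝ := u.re * v.im - u.im * v.re

/-- The linear map of the plane sending `1` to `u` and `I` to `v`. -/
noncomputable def frameMap (u v : ℂ) : ℂ →ₗ[ℝ] ℂ :=
  Complex.reLm.smulRight u + Complex.imLm.smulRight v

lemma frameMap_apply (u v z : ℂ) : frameMap u v z = (z.re : ℂ) * u + (z.im : ℂ) * v := by
  simp [frameMap]

lemma det_frameMap (u v : ℂ) : LinearMap.det (frameMap u v) = cross u v := by
  rw [← LinearMap.det_toMatrix Complex.basisOneI, Matrix.det_fin_two]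
  simp [LinearMap.toMatrix_apply, frameMap_apply, cross]
  ring

lemma area_image_frameMap (p u v : ℂ) (S : Set ℂ) :
    area ((fun z => p + frameMap u v z) '' S) = |cross u v| * area S := by
  have h : (fun z => p + frameMap u v z) '' S = (fun z => p + z) '' (frameMap u v '' S) := by
    rw [Set.image_image]
  rw [h, area, Set.image_add_left, measure_preimage_add, Measure.addHaar_image_linearMap,
    det_frameMap, area, ENNReal.toReal_mul, ENNReal.toReal_ofReal (abs_nonneg _)]

/-- The open right triangle with vertices `0`, `1`, `I`. -/
def openTriangle : Set ℂ := {z | 0 < z.re ∧ 0 < z.im ∧ z.re + z.im < 1}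

lemma volume_openTriangle : volume openTriangle = ENNReal.ofReal (1 / 2) := by
  have h : openTriangle = Complex.measurableEquivRealProd ⁻¹'
      (regionBetween (fun _ => 0) (fun x => 1 - x) (Set.Ioo (0 : ℝ) 1)) := by
    ext z
    simp only [openTriangle, regionBetween, Set.mem_ofPred_eq, Set.mem_preimage,
      Complex.measurableEquivRealProd_apply, Set.mem_Ioo]
    constructor
    · rintro ⟨h1, h2, h3⟩
      exact ⟨⟨h1, by linarith⟩, h2, by linarith⟩
    · rintro ⟨⟨h1, _⟩, h2, h3⟩
      exact ⟨h1, h2, by linarith⟩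
  have hi : ∀ f : ℝ → ℝ, Continuous f → IntegrableOn f (Set.Ioo 0 1) := fun f hf =>
    (hf.integrableOn_Icc (a := 0) (b := 1)).mono_set Set.Ioo_subset_Icc_self
  rw [h, Complex.volume_preserving_equiv_real_prod.measure_preimage_equiv, Measure.volume_eq_prod,
    volume_regionBetween_eq_integral (hi _ (by fun_prop)) (hi _ (by fun_prop)) measurableSet_Ioo
      (fun x hx => by linarith [hx.2]), ← integral_Ioc_eq_integral_Ioo,
    ← intervalIntegral.integral_of_le zero_le_one]
  congr 1
  simp only [Pi.sub_apply, sub_zero]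
  rw [intervalIntegral.integral_sub (by simp) (by simp)]
  norm_num

lemma area_openTriangle : area openTriangle = 1 / 2 := by
  rw [area, volume_openTriangle, ENNReal.toReal_ofReal (by norm_num)]

lemma convex_openTriangle : Convex ℝ openTriangle := by
  rintro x ⟨hx1, hx2, hx3⟩ y ⟨hy1, hy2, hy3⟩ s t hs ht hst
  simp only [openTriangle, Set.mem_ofPred_eq, Complex.add_re, Complex.add_im, Complex.real_smul,
    Complex.re_ofReal_mul, Complex.im_ofReal_mul]
  rcases hs.eq_or_lt with rfl | hs
  · obtain rfl : t = 1 := by linarith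
    simp [hy1, hy2, hy3]
  · refine ⟨by positivity, by positivity, ?_⟩
    nlinarith [mul_le_mul_of_nonneg_left hy3.le ht]

lemma openTriangle_subset_convexHull : openTriangle ⊆ convexHull ℝ {0, 1, Complex.I} := by
  rintro z ⟨h1, h2, h3⟩
  have h0 : (0 : ℂ) ∈ convexHull ℝ {0, 1, Complex.I} := subset_convexHull _ _ (by simp)
  have h1' : (1 : ℂ) ∈ convexHull ℝ {0, 1, Complex.I} := subset_convexHull _ _ (by simp)
  have hI : Complex.I ∈ convexHull ℝ {0, 1, Complex.I} := subset_convexHull _ _ (by simp)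
  have := (convex_convexHull ℝ {0, 1, Complex.I}).sum_mem (t := Finset.univ)
    (w := ![1 - z.re - z.im, z.re, z.im]) (z := ![0, 1, Complex.I])
    (by intro i _; fin_cases i <;> simp <;> linarith)
    (by simp only [Fin.sum_univ_three, Matrix.cons_val]; ring)
    (by intro i _; fin_cases i <;> simpa)
  simpa [Fin.sum_univ_three, Complex.re_add_im] using this

lemma convexHull_subset_closure_openTriangle :
    convexHull ℝ {0, 1, Complex.I} ⊆ closure openTriangle := by
  refine convexHull_min ?_ convex_openTriangle.closure
  have key : ∀ z : ℂ, 0 ≤ z.re → 0 ≤ z.im → z.re + z.im ≤ 1 → z ∈ closure openTriangle := by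
    intro z h1 h2 h3
    have hlim : Filter.Tendsto
        (fun t : ℝ => z + (t : ℂ) * ((1 / 3 : ℝ) + (1 / 3 : ℝ) * Complex.I - z))
        (nhdsWithin 0 (Set.Ioi 0)) (nhds z) := by
      have : Continuous
          (fun t : ℝ => z + (t : ℂ) * ((1 / 3 : ℝ) + (1 / 3 : ℝ) * Complex.I - z)) := by fun_prop
      simpa using (this.tendsto 0).mono_left nhdsWithin_le_nhds
    refine mem_closure_of_tendsto hlim ?_
    filter_upwards [Ioo_mem_nhdsGT (zero_lt_one' ℝ)] with t ⟨ht0, ht1⟩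
    simp only [openTriangle, Set.mem_ofPred_eq, Complex.add_re, Complex.add_im,
      Complex.re_ofReal_mul, Complex.im_ofReal_mul, Complex.sub_re, Complex.sub_im,
      Complex.ofReal_re, Complex.ofReal_im, Complex.I_re, Complex.I_im]
    refine ⟨?_, ?_, ?_⟩ <;> nlinarith
  intro z hz
  simp only [Set.mem_insert_iff, Set.mem_singleton_iff] at hz
  rcases hz with rfl | rfl | rfl <;> apply key <;> simp

lemma area_standard_triangle : area (convexHull ℝ {0, 1, Complex.I}) = 1 / 2 := by
  rw [← area_openTriangle, area, area]
  congr 1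
  refine le_antisymm ?_ (measure_mono openTriangle_subset_convexHull)
  refine (measure_mono convexHull_subset_closure_openTriangle).trans ?_
  rw [closure_eq_self_union_frontier]
  exact (measure_union_le _ _).trans (by rw [convex_openTriangle.addHaar_frontier volume, add_zero])

lemma area_convexHull_triple (p q r : ℂ) :
    area (convexHull ℝ {p, q, r}) = |cross (q - p) (r - p)| / 2 := by
  have h : convexHull ℝ {p, q, r} =
      (fun z => p + frameMap (q - p) (r - p) z) '' convexHull ℝ {0, 1, Complex.I} := by
    have := ((AffineMap.const ℝ ℂ p) + (frameMap (q - p) (r - p)).toAffineMap).image_convexHull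
      {0, 1, Complex.I}
    have hf : ⇑((AffineMap.const ℝ ℂ p) + (frameMap (q - p) (r - p)).toAffineMap) =
      fun z => p + frameMap (q - p) (r - p) z := by ext; simp
    rw [hf] at this
    rw [this]
    simp [Set.image_insert_eq, frameMap_apply]
  rw [h, area_image_frameMap, area_standard_triangle]
  ring

/-- A convex set containing a triangle's vertices, whose relevant open triangle lies in `A`,
meets `A` in at least the area of the triangle. -/
lemma area_triangle_le_area_inter {S A : Set ℂ} (hS : Convex ℝ S) (hfin : volume S ≠ ⊤)
    {p q r : ℂ} (hp : p ∈ S) (hq : q ∈ S) (hr : r ∈ S)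
    (hA : ∀ s t : ℝ, 0 < s → 0 < t → s + t < 1 → p + (s * (q - p) + t * (r - p)) ∈ A) :
    |cross (q - p) (r - p)| / 2 ≤ area (S ∩ A) := by
  have h := area_image_frameMap p (q - p) (r - p) openTriangle
  rw [area_openTriangle] at h
  have hsub : (fun z => p + frameMap (q - p) (r - p) z) '' openTriangle ⊆ S ∩ A := by
    rintro _ ⟨z, ⟨h1, h2, h3⟩, rfl⟩
    simp only [frameMap_apply]
    refine ⟨?_, hA _ _ h1 h2 h3⟩
    have := hS.sum_mem (t := Finset.univ) (w := ![1 - z.re - z.im, z.re, z.im]) (z := ![p, q, r])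
      (by intro i _; fin_cases i <;> simp <;> linarith)
      (by simp only [Fin.sum_univ_three, Matrix.cons_val]; ring)
      (by intro i _; fin_cases i <;> simpa)
    simp only [Fin.sum_univ_three, Matrix.cons_val, Complex.real_smul] at this
    convert this using 1
    push_cast
    ring
  calc |cross (q - p) (r - p)| / 2 = |cross (q - p) (r - p)| * (1 / 2) := by ring
    _ = _ := h.symm
    _ ≤ area (S ∩ A) := ENNReal.toReal_mono
      (ne_top_of_le_ne_top hfin (measure_mono Set.inter_subset_left)) (measure_mono hsub)

lemma sum_area_inter_le {ι : Type*} [Fintype ι] {S : Set ℂ} (hS : MeasurableSet S)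
    (hfin : volume S ≠ ⊤) (A : ι → Set ℂ) (hA : ∀ i, MeasurableSet (A i))
    (hdisj : Pairwise fun i j => Disjoint (S ∩ A i) (S ∩ A j)) :
    ∑ i, area (S ∩ A i) ≤ area S := by
  have hne : ∀ i, volume (S ∩ A i) ≠ ⊤ := fun i =>
    ne_top_of_le_ne_top hfin (measure_mono Set.inter_subset_left)
  simp only [area]
  rw [← ENNReal.toReal_sum fun i _ => hne i]
  refine ENNReal.toReal_mono hfin ?_
  rw [← measure_biUnion_finset (fun i _ j _ hij => hdisj hij) fun i _ => hS.inter (hA i)]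
  exact measure_mono (Set.iUnion₂_subset fun i _ => Set.inter_subset_left)

/-- The barycentric coordinate of `x` at the vertex `a` of the triangle `a b c`. -/
noncomputable def bary (a b c x : ℂ) : ℝ := cross (b - x) (c - x) / cross (b - a) (c - a)

lemma cross_rotate (a b c : ℂ) : cross (c - b) (a - b) = cross (b - a) (c - a) := by
  simp only [cross, Complex.sub_re, Complex.sub_im]; ring

lemma bary_sum {a b c : ℂ} (hD : cross (b - a) (c - a) ≠ 0) (x : ℂ) :
    bary a b c x + bary b c a x + bary c a b x = 1 := by
  rw [bary, bary, bary, cross_rotate a b c, ← cross_rotate c a b, ← add_div, ← add_div,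
    div_eq_one_iff_eq hD]
  simp only [cross, Complex.sub_re, Complex.sub_im]; ring

lemma bary_combination {a b c : ℂ} (hD : cross (b - a) (c - a) ≠ 0) (x : ℂ) :
    bary a b c x * a + bary b c a x * b + bary c a b x * c = x := by
  rw [bary, bary, bary, cross_rotate a b c, ← cross_rotate c a b]
  apply Complex.ext
  all_goals
    simp only [Complex.add_re, Complex.add_im, Complex.re_ofReal_mul, Complex.im_ofReal_mul]
    field_simp
    simp only [cross, Complex.sub_re, Complex.sub_im]
    ring

lemma bary_combo (a b c x y : ℂ) {s t : ℝ} (hst : s + t = 1) :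
    bary a b c (s * x + t * y) = s * bary a b c x + t * bary a b c y := by
  obtain rfl : s = 1 - t := by linarith
  rw [bary, bary, bary, mul_div_assoc', mul_div_assoc', ← add_div]
  congr 1
  simp only [cross, Complex.sub_re, Complex.sub_im, Complex.add_re, Complex.add_im,
    Complex.re_ofReal_mul, Complex.im_ofReal_mul]
  ring

lemma bary_frame (a b c p q r : ℂ) (s t : ℝ) :
    bary a b c (p + (s * (q - p) + t * (r - p))) =
      bary a b c p + (s * (bary a b c q - bary a b c p) + t * (bary a b c r - bary a b c p)) := by
  simp only [bary, ← sub_div, ← mul_div_assoc, ← add_div]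
  congr 1
  simp only [cross, Complex.sub_re, Complex.sub_im, Complex.add_re, Complex.add_im,
    Complex.re_ofReal_mul, Complex.im_ofReal_mul]
  ring

lemma continuous_cross {f g : ℂ → ℂ} (hf : Continuous f) (hg : Continuous g) :
    Continuous fun x => cross (f x) (g x) := by
  unfold cross; fun_prop

lemma continuous_bary (a b c : ℂ) : Continuous (bary a b c) :=
  (continuous_cross (by fun_prop) (by fun_prop)).div_const _

lemma bary_nonneg_of_mem_convexHull {a b c x : ℂ} (hx : x ∈ convexHull ℝ {a, b, c}) :
    0 ≤ bary a b c x := by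
  have hc : Convex ℝ {x | 0 ≤ bary a b c x} := by
    intro x hx y hy s t hs ht hst
    simp only [Set.mem_ofPred_eq, Complex.real_smul] at *
    rw [bary_combo _ _ _ _ _ hst]
    positivity
  refine convexHull_min ?_ hc hx
  intro z hz
  simp only [Set.mem_insert_iff, Set.mem_singleton_iff] at hz
  rcases hz with rfl | rfl | rfl
  · by_cases h : cross (b - z) (c - z) = 0 <;> simp [bary, h]
  · simp [bary, cross]
  · simp [bary, cross]

lemma triple_rotate (a b c : ℂ) : ({b, c, a} : Set ℂ) = {a, b, c} := by
  ext x
  simp only [Set.mem_insert_iff, Set.mem_singleton_iff]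
  tauto

lemma mem_convexHull_of_combination {a b c : ℂ} {r s t : ℝ} (hr : 0 ≤ r) (hs : 0 ≤ s)
    (ht : 0 ≤ t) (h : r + s + t = 1) : r * a + s * b + t * c ∈ convexHull ℝ {a, b, c} := by
  have := (convex_convexHull ℝ {a, b, c}).sum_mem (t := Finset.univ)
    (w := ![r, s, t]) (z := ![a, b, c])
    (by intro i _; fin_cases i <;> simpa) (by simpa [Fin.sum_univ_three])
    (by intro i _; apply subset_convexHull; fin_cases i <;> simp)
  simpa [Fin.sum_univ_three] using this

/-- The relative height in the corner triangle at `a` is attained, and bounds the barycentric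
coordinate on all of `K`. -/
lemma corner_height {a b c : ℂ} (hD : cross (b - a) (c - a) ≠ 0) {K : Set ℂ}
    (hK : IsCompact K) (hKo : K ⊆ convexHull ℝ {a, b, c}) (hb : (c + a) / 2 ∈ K) {α : ℝ}
    (hα : α = sSup ((fun x => area (convexHull ℝ {x, (c + a) / 2, (a + b) / 2}) /
      area (convexHull ℝ {a, (c + a) / 2, (a + b) / 2})) ''
        (K ∩ convexHull ℝ {a, (c + a) / 2, (a + b) / 2}))) :
    0 ≤ α ∧ α ≤ 1 ∧ (∃ x ∈ K, bary a b c x = (1 + α) / 2) ∧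
      ∀ x ∈ K, bary a b c x ≤ (1 + α) / 2 := by
  have hnn : ∀ x ∈ K, 0 ≤ bary a b c x ∧ 0 ≤ bary b c a x ∧ 0 ≤ bary c a b x := fun x hx =>
    ⟨bary_nonneg_of_mem_convexHull (hKo hx),
      bary_nonneg_of_mem_convexHull (by rw [triple_rotate]; exact hKo hx),
      bary_nonneg_of_mem_convexHull (by rw [triple_rotate, triple_rotate]; exact hKo hx)⟩
  set T := convexHull ℝ {a, (c + a) / 2, (a + b) / 2} with hT
  have hbary : ∀ x, bary a ((c + a) / 2) ((a + b) / 2) x = 2 * bary a b c x - 1 := by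
    intro x
    have h4 : cross ((c + a) / 2 - a) ((a + b) / 2 - a) = - cross (b - a) (c - a) / 4 := by
      simp [cross]; ring
    rw [bary, bary, h4]
    field_simp
    simp [cross]; ring
  have hval : Set.EqOn (fun x => area (convexHull ℝ {x, (c + a) / 2, (a + b) / 2}) / area T)
      (fun x => 2 * bary a b c x - 1) (K ∩ T) := by
    rintro x ⟨-, hx⟩
    have h0 := bary_nonneg_of_mem_convexHull hx
    simp only
    rw [hT, area_convexHull_triple, area_convexHull_triple, div_div_div_cancel_right₀ two_ne_zero,
      ← abs_div, ← hbary x, ← bary, abs_of_nonneg h0]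
  rw [hval.image_eq] at hα
  have hcpt : IsCompact (K ∩ T) :=
    hK.inter_right ((Set.toFinite _).isCompact_convexHull ℝ).isClosed
  have hcont : Continuous fun x => 2 * bary a b c x - 1 := by
    have := continuous_bary a b c
    fun_prop
  have hbT : (c + a) / 2 ∈ K ∩ T := ⟨hb, subset_convexHull _ _ (by simp)⟩
  obtain ⟨x, hx, hxα⟩ := hcpt.exists_sSup_image_eq ⟨_, hbT⟩ hcont.continuousOn
  have hle : ∀ y ∈ K ∩ T, 2 * bary a b c y - 1 ≤ α := fun y hy => by
    rw [hα]
    exact le_csSup (hcpt.image hcont).bddAbove ⟨y, hy, rfl⟩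
  have h0 : 0 ≤ α := by
    refine le_trans ?_ (hle _ hx)
    rw [← hbary]
    exact bary_nonneg_of_mem_convexHull hx.2
  rw [← hα] at hxα
  have hs := bary_sum hD x
  obtain ⟨hx1, hx2, hx3⟩ := hnn x hx.1
  refine ⟨h0, by linarith, ⟨x, hx.1, by linarith⟩, fun y hy => ?_⟩
  by_cases hy2 : 1 / 2 ≤ bary a b c y
  · have hyT : y ∈ T := by
      have hs := bary_sum hD y
      obtain ⟨hy3, hy4, hy5⟩ := hnn y hy
      have := mem_convexHull_of_combination (a := a) (b := (c + a) / 2) (c := (a + b) / 2)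
        (r := 2 * bary a b c y - 1) (s := 2 * bary c a b y) (t := 2 * bary b c a y)
        (by linarith) (by linarith) (by linarith) (by linarith)
      rw [hT]
      convert this using 1
      conv_lhs => rw [← bary_combination hD y]
      have hs' : (bary a b c y : ℂ) = 1 - bary b c a y - bary c a b y := by
        rw [← Complex.ofReal_one, ← hs]; push_cast; ring
      push_cast
      rw [hs']
      ring
    linarith [hle y ⟨hy, hyT⟩]
  · linarith

/-- The part of `K` in the corner triangle at `a` has at least the area of the triangle with apex
of relative height `α`. -/
lemma corner_area {a b c : ℂ} (hD : cross (b - a) (c - a) ≠ 0) {K : Set ℂ}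
    (hconv : Convex ℝ K) (hfin : volume K ≠ ⊤) (hb : (c + a) / 2 ∈ K) (hc : (a + b) / 2 ∈ K)
    {α : ℝ} (h0 : 0 ≤ α) {x : ℂ} (hx : x ∈ K) (hxα : bary a b c x = (1 + α) / 2) :
    α * |cross (b - a) (c - a)| / 8 ≤ area (K ∩ {y | 1 / 2 < bary a b c y}) := by
  rcases h0.eq_or_lt with rfl | h0
  · rw [zero_mul, zero_div]
    exact ENNReal.toReal_nonneg
  have hb' : bary a b c ((c + a) / 2) = 1 / 2 := by
    rw [bary, div_eq_iff hD]; simp [cross]; ring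
  have hc' : bary a b c ((a + b) / 2) = 1 / 2 := by
    rw [bary, div_eq_iff hD]; simp [cross]; ring
  have h := area_triangle_le_area_inter (A := {y | 1 / 2 < bary a b c y}) hconv hfin hx hb hc
    (by
      intro s t hs ht hst
      simp only [Set.mem_ofPred_eq]
      rw [bary_frame, hxα, hb', hc']
      nlinarith)
  refine le_trans (le_of_eq ?_) h
  have : cross ((c + a) / 2 - x) ((a + b) / 2 - x) = - α * cross (b - a) (c - a) / 4 := by
    have h1 : cross ((c + a) / 2 - x) ((a + b) / 2 - x) =
      - (2 * bary a b c x - 1) * cross (b - a) (c - a) / 4 := by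
      rw [bary]
      field_simp
      simp [cross]; ring
    rw [h1, hxα]; ring
  rw [this, abs_div, abs_mul, abs_neg, abs_of_pos h0, abs_of_pos (by norm_num : (0 : ℝ) < 4)]
  ring

lemma medial_area {a b c : ℂ} (hD : cross (b - a) (c - a) ≠ 0) {K : Set ℂ}
    (hconv : Convex ℝ K) (hfin : volume K ≠ ⊤) (ha : (b + c) / 2 ∈ K) (hb : (c + a) / 2 ∈ K)
    (hc : (a + b) / 2 ∈ K) :
    |cross (b - a) (c - a)| / 8 ≤
      area (K ∩ {y | bary a b c y < 1 / 2 ∧ bary b c a y < 1 / 2 ∧ bary c a b y < 1 / 2}) := by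
  have hD2 : cross (c - b) (a - b) ≠ 0 := by rwa [cross_rotate]
  have hD3 : cross (a - c) (b - c) ≠ 0 := by rwa [cross_rotate, cross_rotate]
  have mid1 : ∀ a b c : ℂ, cross (b - a) (c - a) ≠ 0 →
      bary a b c ((b + c) / 2) = 0 ∧ bary a b c ((c + a) / 2) = 1 / 2 ∧
        bary a b c ((a + b) / 2) = 1 / 2 := by
    intro a b c hD
    refine ⟨?_, ?_, ?_⟩ <;> (rw [bary, div_eq_iff hD]; simp [cross]; ring)
  obtain ⟨a1, a2, a3⟩ := mid1 a b c hD
  obtain ⟨b1, b2, b3⟩ := mid1 b c a hD2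
  obtain ⟨c1, c2, c3⟩ := mid1 c a b hD3
  refine le_trans (le_of_eq ?_) (area_triangle_le_area_inter hconv hfin ha hb hc ?_)
  · have : cross ((c + a) / 2 - (b + c) / 2) ((a + b) / 2 - (b + c) / 2) =
        cross (b - a) (c - a) / 4 := by
      simp [cross]; ring
    rw [this, abs_div, abs_of_pos (by norm_num : (0 : ℝ) < 4)]
    ring
  · intro s t hs ht hst
    simp only [Set.mem_ofPred_eq, bary_frame, a1, a2, a3, b1, b2, b3, c1, c2, c3]
    refine ⟨?_, ?_, ?_⟩ <;> linarith

/-- Lower bound for the area of a convex set between a triangle and its medial triangle. -/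
lemma area_body_ge {a b c : ℂ} (hD : cross (b - a) (c - a) ≠ 0) {K : Set ℂ}
    (hconv : Convex ℝ K) (hcpt : IsCompact K) (hKo : K ⊆ convexHull ℝ {a, b, c})
    (ha : (b + c) / 2 ∈ K) (hb : (c + a) / 2 ∈ K) (hc : (a + b) / 2 ∈ K)
    {α β γ : ℝ} (hα : 0 ≤ α) (hβ : 0 ≤ β) (hγ : 0 ≤ γ)
    (hx : ∃ x ∈ K, bary a b c x = (1 + α) / 2) (hy : ∃ x ∈ K, bary b c a x = (1 + β) / 2)
    (hz : ∃ x ∈ K, bary c a b x = (1 + γ) / 2) :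
    (1 + α + β + γ) * |cross (b - a) (c - a)| / 8 ≤ area K := by
  obtain ⟨x, hx, hxα⟩ := hx
  obtain ⟨y, hy, hyβ⟩ := hy
  obtain ⟨z, hz, hzγ⟩ := hz
  have hfin := hcpt.measure_ne_top (μ := volume)
  have e2 : cross (c - b) (a - b) = cross (b - a) (c - a) := cross_rotate a b c
  have e3 : cross (a - c) (b - c) = cross (b - a) (c - a) := by rw [cross_rotate, cross_rotate]
  have m := medial_area hD hconv hfin ha hb hc
  have m1 := corner_area hD hconv hfin hb hc hα hx hxα
  have m2 := corner_area (e2 ▸ hD) hconv hfin hc ha hβ hy hyβ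
  have m3 := corner_area (e3 ▸ hD) hconv hfin ha hb hγ hz hzγ
  rw [e2] at m2
  rw [e3] at m3
  have hnn : ∀ w ∈ K, 0 ≤ bary a b c w ∧ 0 ≤ bary b c a w ∧ 0 ≤ bary c a b w ∧
      bary a b c w + bary b c a w + bary c a b w = 1 := fun w hw =>
    ⟨bary_nonneg_of_mem_convexHull (hKo hw),
      bary_nonneg_of_mem_convexHull (by rw [triple_rotate]; exact hKo hw),
      bary_nonneg_of_mem_convexHull (by rw [triple_rotate, triple_rotate]; exact hKo hw),
      bary_sum hD w⟩
  have c1 := continuous_bary a b c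
  have c2 := continuous_bary b c a
  have c3 := continuous_bary c a b
  have hsum := sum_area_inter_le hcpt.measurableSet hfin
    ![{y | bary a b c y < 1 / 2 ∧ bary b c a y < 1 / 2 ∧ bary c a b y < 1 / 2},
      {y | 1 / 2 < bary a b c y}, {y | 1 / 2 < bary b c a y}, {y | 1 / 2 < bary c a b y}]
    (by
      intro i
      fin_cases i
      · exact ((isOpen_lt c1 continuous_const).inter ((isOpen_lt c2 continuous_const).inter
          (isOpen_lt c3 continuous_const))).measurableSet
      · exact (isOpen_lt continuous_const c1).measurableSet
      · exact (isOpen_lt continuous_const c2).measurableSet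
      · exact (isOpen_lt continuous_const c3).measurableSet)
    (by
      intro i j hij
      rw [Set.disjoint_left]
      rintro w ⟨hw, hi⟩ ⟨-, hj⟩
      obtain ⟨w1, w2, w3, w4⟩ := hnn w hw
      fin_cases i <;> fin_cases j <;> simp at hij hi hj <;> linarith)
  simp only [Fin.sum_univ_four, Matrix.cons_val] at hsum
  linarith

lemma real_inner_eq (x y : ℂ) : ⟪x, y⟫ = x.re * y.re + x.im * y.im := by
  rw [Complex.inner]; simp; ring

/-- The gradient of the barycentric coordinate at the vertex `a`. -/
noncomputable def baryGrad (a b c : ℂ) : ℂ :=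
  (cross (b - a) (c - a))⁻¹ • (Complex.I * (c - b))

lemma inner_baryGrad (a b c x y : ℂ) :
    ⟪baryGrad a b c, x - y⟫ = bary a b c x - bary a b c y := by
  rw [real_inner_eq, bary, bary, baryGrad, ← sub_div]
  simp only [Complex.real_smul, Complex.re_ofReal_mul, Complex.im_ofReal_mul, div_eq_inv_mul,
    mul_assoc, ← mul_add]
  congr 1
  simp [cross]
  ring

lemma baryGrad_swap (a b c : ℂ) : baryGrad a c b = baryGrad a b c := by
  have : cross (c - a) (b - a) = - cross (b - a) (c - a) := by simp [cross]; ring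
  rw [baryGrad, baryGrad, this, inv_neg, neg_smul, ← smul_neg]
  congr 1
  ring

lemma cross_baryGrad {a b c : ℂ} (hD : cross (b - a) (c - a) ≠ 0) :
    cross (baryGrad a b c) (baryGrad c a b) = -(cross (b - a) (c - a))⁻¹ := by
  have hsmul : ∀ (r s : ℝ) (u v : ℂ), cross (r • u) (s • v) = r * s * cross u v := fun r s u v => by
    simp [cross]; ring
  have hI : cross (Complex.I * (c - b)) (Complex.I * (b - a)) = -cross (b - a) (c - a) := by
    simp [cross]; ring
  rw [baryGrad, baryGrad, ← cross_rotate c a b, hsmul, hI]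
  field_simp

lemma bary_vertices {a b c : ℂ} (hD : cross (b - a) (c - a) ≠ 0) :
    bary a b c a = 1 ∧ bary a b c b = 0 ∧ bary a b c c = 0 :=
  ⟨div_self hD, by simp [bary, cross], by simp [bary, cross]⟩

lemma convex_polarBody (L : Set ℂ) : Convex ℝ (polarBody L) := by
  intro x hx y hy s t hs ht hst z hz
  rw [inner_add_left, real_inner_smul_left, real_inner_smul_left]
  nlinarith [hx z hz, hy z hz]

lemma isClosed_polarBody (L : Set ℂ) : IsClosed (polarBody L) := by
  have : polarBody L = ⋂ y ∈ L, {x | ⟪x, y⟫ ≤ 1} := by ext; simp [polarBody]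
  rw [this]
  exact isClosed_biInter fun y _ => isClosed_le (by fun_prop) continuous_const

lemma zero_mem_polarBody (L : Set ℂ) : (0 : ℂ) ∈ polarBody L := fun y _ => by simp

lemma volume_polarBody_ne_top {K : Set ℂ} (hK : (interior K).Nonempty) :
    volume (polarBody ((2⁻¹ : ℝ) • (K - K))) ≠ ⊤ := by
  obtain ⟨x, hx⟩ := hK
  obtain ⟨ε, hε, hball⟩ := Metric.isOpen_iff.1 isOpen_interior x hx
  have hsub : polarBody ((2⁻¹ : ℝ) • (K - K)) ⊆ Metric.closedBall 0 (4 / ε) := by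
    intro z hz
    rw [mem_closedBall_zero_iff]
    by_cases h0 : z = 0
    · rw [h0, norm_zero]; positivity
    have hpos : 0 < ‖z‖ := norm_pos_iff.2 h0
    set y : ℂ := (ε / 2 / ‖z‖) • z with hy
    have hyn : ‖y‖ < ε := by
      rw [hy, norm_smul, Real.norm_of_nonneg (by positivity), div_mul_cancel₀ _ hpos.ne']
      linarith
    have h1 : x + y ∈ K := interior_subset (hball (by simpa using hyn))
    have h2 : x ∈ K := interior_subset hx
    have := hz _ (Set.smul_mem_smul_set (Set.sub_mem_sub h1 h2))
    rw [add_sub_cancel_left, real_inner_smul_right, hy, real_inner_smul_right,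
      real_inner_self_eq_norm_sq] at this
    rw [le_div_iff₀ hε]
    have e : (2 : ℝ)⁻¹ * (ε / 2 / ‖z‖ * ‖z‖ ^ 2) = ‖z‖ * ε / 4 := by field_simp; norm_num
    linarith
  exact ne_top_of_le_ne_top (isCompact_closedBall _ _).measure_ne_top (measure_mono hsub)

lemma smul_baryGrad_mem_polarBody {a b c : ℂ} {K : Set ℂ} {α : ℝ} (hα : 0 ≤ α)
    (hK : ∀ x ∈ K, 0 ≤ bary a b c x ∧ bary a b c x ≤ (1 + α) / 2) :
    (4 / (1 + α)) • baryGrad a b c ∈ polarBody ((2⁻¹ : ℝ) • (K - K)) ∧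
      -((4 / (1 + α)) • baryGrad a b c) ∈ polarBody ((2⁻¹ : ℝ) • (K - K)) := by
  have hpos : 0 < 1 + α := by linarith
  constructor
  all_goals
    rintro _ ⟨_, ⟨x, hx, y, hy, rfl⟩, rfl⟩
    obtain ⟨x1, x2⟩ := hK x hx
    obtain ⟨y1, y2⟩ := hK y hy
    simp only [inner_neg_left, real_inner_smul_left, real_inner_smul_right, inner_baryGrad]
    rw [div_mul_eq_mul_div, mul_div_assoc']
  · rw [div_le_iff₀ hpos]; linarith
  · rw [← neg_div, div_le_iff₀ hpos]; linarith

lemma polar_sector_area {a b c : ℂ} (hD : cross (b - a) (c - a) ≠ 0) {P : Set ℂ}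
    (hP : Convex ℝ P) (hfin : volume P ≠ ⊤) (h0 : 0 ∈ P) {s t : ℝ} (hs : 0 < s) (ht : 0 < t)
    (hsP : s • baryGrad a b c ∈ P) (htP : -(t • baryGrad c a b) ∈ P) :
    s * t / (2 * |cross (b - a) (c - a)|) ≤
      area (P ∩ {z | 0 < ⟪z, a - b⟫ ∧ 0 < ⟪z, b - c⟫}) := by
  obtain ⟨a1, a2, a3⟩ := bary_vertices hD
  obtain ⟨c1, c2, c3⟩ := bary_vertices (a := c) (b := a) (c := b)
    (by rwa [cross_rotate, cross_rotate])
  refine le_trans (le_of_eq ?_) (area_triangle_le_area_inter hP hfin h0 hsP htP ?_)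
  · have : cross (s • baryGrad a b c - 0) (-(t • baryGrad c a b) - 0) =
        s * t * -cross (baryGrad a b c) (baryGrad c a b) := by
      simp [cross]; ring
    rw [this, cross_baryGrad hD, neg_neg, abs_mul, abs_inv, abs_of_pos (mul_pos hs ht)]
    field_simp
  · intro p q hp hq _
    simp only [Set.mem_ofPred_eq, sub_zero, zero_add, ← Complex.real_smul, inner_add_left,
      inner_neg_left, real_inner_smul_left, inner_baryGrad, smul_neg, a1, a2, a3, c1, c2, c3]
    constructor
    · have := mul_pos hp hs
      linarith
    · have := mul_pos hq ht
      linarith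

/-- The six sectors given by the strict orderings of `⟪z, a⟫`, `⟪z, b⟫`, `⟪z, c⟫`. -/
def orderSectors (a b c : ℂ) : Fin 6 → Set ℂ :=
  ![{z | 0 < ⟪z, a - b⟫ ∧ 0 < ⟪z, b - c⟫}, {z | 0 < ⟪z, b - c⟫ ∧ 0 < ⟪z, c - a⟫},
    {z | 0 < ⟪z, c - a⟫ ∧ 0 < ⟪z, a - b⟫}, {z | 0 < ⟪z, a - c⟫ ∧ 0 < ⟪z, c - b⟫},
    {z | 0 < ⟪z, b - a⟫ ∧ 0 < ⟪z, a - c⟫}, {z | 0 < ⟪z, c - b⟫ ∧ 0 < ⟪z, b - a⟫}]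

lemma pairwise_disjoint_orderSectors (a b c : ℂ) :
    Pairwise fun i j => Disjoint (orderSectors a b c i) (orderSectors a b c j) := by
  intro i j hij
  rw [Set.disjoint_left]
  intro w hi hj
  fin_cases i <;> fin_cases j <;>
    first
    | exact absurd rfl hij
    | (obtain ⟨h1, h2⟩ := hi
       obtain ⟨h3, h4⟩ := hj
       rw [inner_sub_right] at h1 h2 h3 h4
       linarith)

/-- Lower bound for the area of a convex set containing the hexagon spanned by multiples of the
gradients of the barycentric coordinates. -/
lemma area_polar_ge {a b c : ℂ} (hD : cross (b - a) (c - a) ≠ 0) {P : Set ℂ}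
    (hP : Convex ℝ P) (hclosed : IsClosed P) (hfin : volume P ≠ ⊤) (h0 : 0 ∈ P) {r s t : ℝ}
    (hr : 0 < r) (hs : 0 < s) (ht : 0 < t)
    (hrP : r • baryGrad a b c ∈ P ∧ -(r • baryGrad a b c) ∈ P)
    (hsP : s • baryGrad b c a ∈ P ∧ -(s • baryGrad b c a) ∈ P)
    (htP : t • baryGrad c a b ∈ P ∧ -(t • baryGrad c a b) ∈ P) :
    (r * s + s * t + t * r) / |cross (b - a) (c - a)| ≤ area P := by
  have e2 : cross (c - b) (a - b) = cross (b - a) (c - a) := cross_rotate a b c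
  have e3 : cross (a - c) (b - c) = cross (b - a) (c - a) := by rw [cross_rotate, cross_rotate]
  have eswap : ∀ u v : ℂ, cross v u = -cross u v := fun u v => by simp [cross]; ring
  have d2 := e2 ▸ hD
  have d3 := e3 ▸ hD
  have s1 := polar_sector_area hD hP hfin h0 hr ht hrP.1 htP.2
  have s2 := polar_sector_area d2 hP hfin h0 hs hr hsP.1 hrP.2
  have s3 := polar_sector_area d3 hP hfin h0 ht hs htP.1 hsP.2
  have s4 := polar_sector_area (a := a) (b := c) (c := b) (by rwa [eswap, neg_ne_zero]) hP hfin h0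
    hr hs (by rw [baryGrad_swap]; exact hrP.1) (by rw [baryGrad_swap]; exact hsP.2)
  have s5 := polar_sector_area (a := b) (b := a) (c := c) (by rwa [eswap, neg_ne_zero]) hP hfin h0
    hs ht (by rw [baryGrad_swap]; exact hsP.1) (by rw [baryGrad_swap]; exact htP.2)
  have s6 := polar_sector_area (a := c) (b := b) (c := a) (by rwa [eswap, neg_ne_zero]) hP hfin h0
    ht hr (by rw [baryGrad_swap]; exact htP.1) (by rw [baryGrad_swap]; exact hrP.2)
  rw [e2] at s2
  rw [e3] at s3
  rw [eswap, abs_neg] at s4 s5 s6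
  rw [e2] at s5
  rw [e3] at s6
  have hopen : ∀ u : ℂ, IsOpen {z : ℂ | 0 < ⟪z, u⟫} := fun u =>
    isOpen_lt continuous_const (by fun_prop)
  have hsum := sum_area_inter_le hclosed.measurableSet hfin (orderSectors a b c)
    (by intro i; fin_cases i <;> exact ((hopen _).inter (hopen _)).measurableSet)
    (fun i j hij => (pairwise_disjoint_orderSectors a b c hij).mono Set.inter_subset_right
      Set.inter_subset_right)
  simp only [orderSectors, Fin.sum_univ_six, Matrix.cons_val] at hsum
  refine le_trans (le_of_eq ?_) ((add_le_add (add_le_add (add_le_add (add_le_add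
    (add_le_add s1 s2) s3) s4) s5) s6).trans hsum)
  have hpos := abs_pos.2 hD
  field_simp
  ring

lemma eggleston_numeric {x y z α : ℝ} (hx : 0 ≤ x) (hy : 0 ≤ y) (hz : 0 ≤ z) (hx1 : x ≤ 1)
    (hy1 : y ≤ 1) (hz1 : z ≤ 1) (hα : α = (x + y + z) / 3) :
    6 + (3 / 2) * (α * (1 - α)) ≤ (1 + x + y + z) / 8 *
      (4 / (1 + x) * (4 / (1 + y)) + 4 / (1 + y) * (4 / (1 + z)) + 4 / (1 + z) * (4 / (1 + x))) := by
  have h0 : 0 ≤ α := by rw [hα]; positivity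
  have h1 : α ≤ 1 := by linarith
  have hprod : (1 + x) * (1 + y) * (1 + z) ≤ (1 + α) ^ 3 := by
    rw [hα]
    nlinarith [mul_nonneg hx (sq_nonneg (y - z)), mul_nonneg hy (sq_nonneg (z - x)),
      mul_nonneg hz (sq_nonneg (x - y)), sq_nonneg (x - y), sq_nonneg (y - z), sq_nonneg (z - x),
      mul_nonneg (add_nonneg (add_nonneg hx hy) hz) (sq_nonneg (x - y)),
      mul_nonneg (add_nonneg (add_nonneg hx hy) hz) (sq_nonneg (y - z)),
      mul_nonneg (add_nonneg (add_nonneg hx hy) hz) (sq_nonneg (z - x))]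
  have e : (1 + x + y + z) / 8 *
      (4 / (1 + x) * (4 / (1 + y)) + 4 / (1 + y) * (4 / (1 + z)) + 4 / (1 + z) * (4 / (1 + x))) =
      6 * (1 + 3 * α) * (1 + α) / ((1 + x) * (1 + y) * (1 + z)) := by
    rw [hα]
    field_simp
    ring
  have hα1 : 0 ≤ α * (1 - α) := mul_nonneg h0 (by linarith)
  rw [e]
  calc 6 + (3 / 2) * (α * (1 - α)) ≤ 6 * (1 + 3 * α) * (1 + α) / (1 + α) ^ 3 := by
        rw [le_div_iff₀ (by positivity)]
        have h4 : 0 ≤ 4 - (1 + α) ^ 2 := by nlinarith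
        nlinarith [mul_nonneg (mul_nonneg hα1 h4) (by linarith : 0 ≤ 1 + α)]
    _ ≤ _ := by gcongr

lemma cross_ne_zero_of_equilateral {a b c : ℂ} (hab : dist a b = 2) (hbc : dist b c = 2)
    (hca : dist c a = 2) : cross (b - a) (c - a) ≠ 0 := by
  have h : ∀ u v : ℂ, dist u v = 2 → (u.re - v.re) ^ 2 + (u.im - v.im) ^ 2 = 4 := by
    intro u v huv
    rw [Complex.dist_eq_re_im, Real.sqrt_eq_iff_eq_sq (by positivity) (by norm_num)] at huv
    linarith
  have h1 := h _ _ hab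
  have h2 := h _ _ hbc
  have h3 := h _ _ hca
  intro h0
  simp only [cross, Complex.sub_re, Complex.sub_im] at h0
  have h4 : (b.re - a.re) * (c.re - a.re) + (b.im - a.im) * (c.im - a.im) = 2 := by linarith
  have h5 : ((b.re - a.re) * (c.re - a.re) + (b.im - a.im) * (c.im - a.im)) ^ 2 +
      ((b.re - a.re) * (c.im - a.im) - (b.im - a.im) * (c.re - a.re)) ^ 2 =
      ((a.re - b.re) ^ 2 + (a.im - b.im) ^ 2) * ((c.re - a.re) ^ 2 + (c.im - a.im) ^ 2) := by ring
  rw [h4, h0, h1, h3] at h5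
  norm_num at h5

/-- The quantitative Eggleston lemma: for an equilateral triangle `K_o = [a,b,c]` of
side `2`, its medial triangle `K_i = [a',b',c']`, a convex body `K_i ⊆ K ⊆ K_o`, and
`α = (α₁+α₂+α₃)/3` the mean of the three maximal relative heights of `K` in the
corner triangles, one has `|K|·|((K−K)/2)*| ≥ 6 + (3/2)·α(1−α)`. -/
theorem eggleston_lemma (a b c : ℂ)
    (hab : dist a b = 2) (hbc : dist b c = 2) (hca : dist c a = 2)
    (a' b' c' : ℂ) (ha' : a' = (b + c) / 2) (hb' : b' = (c + a) / 2) (hc' : c' = (a + b) / 2)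
    (Ko Ki K : Set ℂ)
    (hKo : Ko = convexHull ℝ {a, b, c}) (hKi : Ki = convexHull ℝ {a', b', c'})
    (hK : IsConvexBody K) (h1 : Ki ⊆ K) (h2 : K ⊆ Ko)
    (α1 α2 α3 α : ℝ)
    (hα1 : α1 = sSup ((fun x => area (convexHull ℝ {x, b', c'}) /
      area (convexHull ℝ {a, b', c'})) '' (K ∩ convexHull ℝ {a, b', c'})))
    (hα2 : α2 = sSup ((fun x => area (convexHull ℝ {x, c', a'}) /
      area (convexHull ℝ {b, c', a'})) '' (K ∩ convexHull ℝ {b, c', a'})))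
    (hα3 : α3 = sSup ((fun x => area (convexHull ℝ {x, a', b'}) /
      area (convexHull ℝ {c, a', b'})) '' (K ∩ convexHull ℝ {c, a', b'})))
    (hα : α = (α1 + α2 + α3) / 3) :
    6 + (3 / 2) * (α * (1 - α)) ≤ area K * area (polarBody ((2⁻¹ : ℝ) • (K - K))) := by
  subst ha' hb' hc' hKo hKi
  obtain ⟨hconv, hcpt, hint⟩ := hK
  have hD := cross_ne_zero_of_equilateral hab hbc hca
  have e2 : cross (c - b) (a - b) = cross (b - a) (c - a) := cross_rotate a b c
  have e3 : cross (a - c) (b - c) = cross (b - a) (c - a) := by rw [cross_rotate, cross_rotate]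
  have ha : (b + c) / 2 ∈ K := h1 (subset_convexHull _ _ (by simp))
  have hb : (c + a) / 2 ∈ K := h1 (subset_convexHull _ _ (by simp))
  have hc : (a + b) / 2 ∈ K := h1 (subset_convexHull _ _ (by simp))
  have h2' : K ⊆ convexHull ℝ {b, c, a} := by rwa [triple_rotate]
  have h2'' : K ⊆ convexHull ℝ {c, a, b} := by rwa [triple_rotate, triple_rotate]
  obtain ⟨p1, q1, x1, u1⟩ := corner_height hD hcpt h2 hb hα1
  obtain ⟨p2, q2, x2, u2⟩ := corner_height (e2 ▸ hD) hcpt h2' hc hα2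
  obtain ⟨p3, q3, x3, u3⟩ := corner_height (e3 ▸ hD) hcpt h2'' ha hα3
  have hK := area_body_ge hD hconv hcpt h2 ha hb hc p1 p2 p3 x1 x2 x3
  have hP := area_polar_ge hD (convex_polarBody _) (isClosed_polarBody _)
    (volume_polarBody_ne_top hint) (zero_mem_polarBody _) (r := 4 / (1 + α1))
    (s := 4 / (1 + α2)) (t := 4 / (1 + α3)) (by positivity) (by positivity) (by positivity)
    (smul_baryGrad_mem_polarBody p1 fun x hx =>
      ⟨bary_nonneg_of_mem_convexHull (h2 hx), u1 x hx⟩)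
    (smul_baryGrad_mem_polarBody p2 fun x hx =>
      ⟨bary_nonneg_of_mem_convexHull (h2' hx), u2 x hx⟩)
    (smul_baryGrad_mem_polarBody p3 fun x hx =>
      ⟨bary_nonneg_of_mem_convexHull (h2'' hx), u3 x hx⟩)
  have hpos := abs_pos.2 hD
  refine (eggleston_numeric p1 p2 p3 q1 q2 q3 hα).trans
    (le_trans (le_of_eq ?_) (mul_le_mul hK hP (by positivity) ENNReal.toReal_nonneg))
  field_simp
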